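/- arXiv:2506.07635 — 6 statements merged into one kernel-verified Lean document; each statement's English description precedes it below -/
import Mathlib

section
/- Let X be a set, f : X → Set X a set-valued transition map, X₀ ⊆ X a set of initial states and Xᵤ ⊆ X a set of unsafe states. Suppose there exists a function B : X → ℝ such that (i) B(x) ≤ 0 for all x ∈ X₀, (ii) B(x) > 0 for all x ∈ Xᵤ, and (iii) B(x') − B(x) ≤ 0 for all x ∈ X and all x' ∈ f(x). Then the system is safe: every trace x : ℕ → X with x(0) ∈ X₀ and x(t+1) ∈ f(x(t)) for all t satisfies x(t) ∉ Xᵤ for all t ∈ ℕ. -/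
/-- Soundness of (invariant) barrier certificates for discrete-time set-valued systems. -/
theorem barrier_certificate_safety {X : Type*} (f : X → Set X) (X0 Xu : Set X)
    (B : X → ℝ)
    (hInit : ∀ x ∈ X0, B x ≤ 0)
    (hUnsafe : ∀ x ∈ Xu, 0 < B x)
    (hDec : ∀ x : X, ∀ x' ∈ f x, B x' - B x ≤ 0) :
    ∀ x : ℕ → X, x 0 ∈ X0 → (∀ t : ℕ, x (t + 1) ∈ f (x t)) →
      ∀ t : ℕ, x t ∉ Xu := by
  intro x hx0 hstep t ht
  have hB : Antitone (B ∘ x) :=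
    antitone_nat_of_succ_le fun n ↦ sub_nonpos.mp (hDec _ _ (hstep n))
  exact (hUnsafe _ ht).not_ge ((hB t.zero_le).trans (hInit _ hx0))
end

section
/- Let X be a set, f : X → Set X a set-valued transition map, X₀ ⊆ X a set of initial states and Xᵤ ⊆ X a set of unsafe states. Suppose there exist a natural number k ≥ 1, real numbers ε ≥ 0 and d with d > k·ε, and a function B : X → ℝ such that (i) B(x) ≤ 0 for all x ∈ X₀, (ii) B(x) ≥ d for all x ∈ Xᵤ, (iii) B(x') − B(x) ≤ ε for all x ∈ X and all x' ∈ f(x), and (iv) B(x'') − B(x) ≤ 0 for all x ∈ X and every x'' reachable from x in exactly k steps of f. Then the system is safe: every trace x : ℕ → X with x(0) ∈ X₀ and x(t+1) ∈ f(x(t)) for all t satisfies x(t) ∉ Xᵤ for all t ∈ ℕ. -/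
/-- Soundness of k-inductive barrier certificates. -/
theorem k_inductive_barrier_certificate_safety {X : Type*} (f : X → Set X)
    (X0 Xu : Set X) (B : X → ℝ) (k : ℕ) (ε d : ℝ)
    (hk : 1 ≤ k) (hε : 0 ≤ ε) (hd : (k : ℝ) * ε < d)
    (hInit : ∀ x ∈ X0, B x ≤ 0)
    (hUnsafe : ∀ x ∈ Xu, d ≤ B x)
    (hStep : ∀ x : X, ∀ x' ∈ f x, B x' - B x ≤ ε)
    (hKInd : ∀ x : X, ∀ y : ℕ → X, y 0 = x →
      (∀ i < k, y (i + 1) ∈ f (y i)) → B (y k) - B x ≤ 0) :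
    ∀ x : ℕ → X, x 0 ∈ X0 → (∀ t : ℕ, x (t + 1) ∈ f (x t)) →
      ∀ t : ℕ, x t ∉ Xu := by
  intro x hx0 hx t ht
  have drift : ∀ s r : ℕ, B (x (s + r)) ≤ B (x s) + r * ε := by
    intro s r
    induction r with
    | zero => simp
    | succ r ih =>
      have h := hStep _ _ (hx (s + r))
      rw [← add_assoc]
      push_cast
      linarith
  have block : ∀ q : ℕ, B (x (k * q)) ≤ 0 := by
    intro q
    induction q with
    | zero => simpa using hInit _ hx0
    | succ q ih =>
      have h := hKInd (x (k * q)) (fun i => x (k * q + i)) rfl fun i _ => hx (k * q + i)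
      rw [Nat.mul_succ]
      linarith
  have hdrift := drift (k * (t / k)) (t % k)
  rw [Nat.div_add_mod] at hdrift
  have hmod : ((t % k : ℕ) : ℝ) * ε ≤ k * ε :=
    mul_le_mul_of_nonneg_right (by exact_mod_cast (Nat.mod_lt t hk).le) hε
  linarith [block (t / k), hUnsafe _ ht]
end

section
/- Let a : ℕ → ℝ be a real sequence, k ≥ 1 a natural number, and ε ≥ 0 a real number. Assume a(0) ≤ 0, a(t+1) − a(t) ≤ ε for all t ∈ ℕ, and a(t+k) − a(t) ≤ 0 for all t ∈ ℕ. Then a(t) ≤ (k−1)·ε for all t ∈ ℕ. -/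
/-- A sequence whose increments are at most `ε` grows at most linearly with slope `ε`. -/
theorem le_add_mul_of_forall_sub_le {a : ℕ → ℝ} {ε : ℝ}
    (hStep : ∀ t : ℕ, a (t + 1) - a t ≤ ε) (t : ℕ) : a t ≤ a 0 + t * ε := by
  induction t with
  | zero => simp
  | succ n ih =>
    push_cast
    linarith [hStep n]

/-- Real-sequence lemma underlying soundness of k-inductive barrier certificates. -/
theorem k_inductive_sequence_bound (a : ℕ → ℝ) (k : ℕ) (ε : ℝ)
    (hk : 1 ≤ k) (hε : 0 ≤ ε)
    (h0 : a 0 ≤ 0)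
    (hStep : ∀ t : ℕ, a (t + 1) - a t ≤ ε)
    (hWindow : ∀ t : ℕ, a (t + k) - a t ≤ 0) :
    ∀ t : ℕ, a t ≤ ((k : ℝ) - 1) * ε := by
  intro t
  induction t using Nat.strong_induction_on with
  | _ t ih =>
    rcases lt_or_ge t k with h | h
    · have htk : (t : ℝ) ≤ (k : ℝ) - 1 := by
        have : (t : ℝ) + 1 ≤ k := by exact_mod_cast h
        linarith
      linarith [le_add_mul_of_forall_sub_le hStep t, mul_le_mul_of_nonneg_right htk hε]
    · have hw := hWindow (t - k)
      rw [Nat.sub_add_cancel h] at hw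
      linarith [ih (t - k) (by omega)]
end

section
/- Let X be a set, f : X → Set X a set-valued transition map, X₀ ⊆ X a set of initial states, Xᵤ ⊆ X a set of unsafe states, and T ∈ ℕ a time horizon. Suppose there exist real numbers δ ≥ 0, γ, λ with γ + δ·T < λ, and a function B : X → ℝ such that (i) B(x) ≤ γ for all x ∈ X₀, (ii) B(x) ≥ λ for all x ∈ Xᵤ, and (iii) B(x') − B(x) ≤ δ for all x ∈ X and all x' ∈ f(x). Then every trace x : ℕ → X with x(0) ∈ X₀ and x(t+1) ∈ f(x(t)) for all t satisfies x(i) ∉ Xᵤ for all i with 0 ≤ i ≤ T. -/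
/-- Soundness of finite horizon barrier certificates. -/
theorem finite_horizon_barrier_certificate_safety {X : Type*} (f : X → Set X)
    (X0 Xu : Set X) (T : ℕ) (B : X → ℝ) (δ γ lam : ℝ)
    (hδ : 0 ≤ δ) (hgl : γ + δ * T < lam)
    (hInit : ∀ x ∈ X0, B x ≤ γ)
    (hUnsafe : ∀ x ∈ Xu, lam ≤ B x)
    (hStep : ∀ x : X, ∀ x' ∈ f x, B x' - B x ≤ δ) :
    ∀ x : ℕ → X, x 0 ∈ X0 → (∀ t : ℕ, x (t + 1) ∈ f (x t)) →
      ∀ i : ℕ, i ≤ T → x i ∉ Xu := by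
  intro x h0 htrace i hi hu
  have bound : ∀ t : ℕ, B (x t) ≤ γ + δ * t := by
    intro t
    induction t with
    | zero => simpa using hInit _ h0
    | succ t ih =>
      have h := hStep _ _ (htrace t)
      push_cast
      linarith
  have hiT : δ * (i : ℝ) ≤ δ * T := by gcongr
  linarith [bound i, hUnsafe _ hu]
end

section
/- Let X be a set, f : ℕ → X → Set X a time-varying set-valued transition map, X₀ ⊆ X a set of initial states and Xᵤ ⊆ X a set of unsafe states. Suppose there exist a family of functions B : ℕ → X → ℝ, a natural number k ≥ 1, and real numbers ε ≥ 0, γ ≥ 0, d with d > k·(ε + γ) such that: (i) B(0, z) ≤ 0 for all z ∈ X₀; (ii) B(t, z) ≥ d for all z ∈ Xᵤ and all t ∈ ℕ; (iii) B(t, z') − B(t, z) ≤ ε for all t ∈ ℕ, all z ∈ X and all z' ∈ f(t)(z); (iv) B(t+1, z) − B(t, z) ≤ γ for all z ∈ X and all t ∈ ℕ; (v) B(t+k, z'') − B(t, z) ≤ 0 for all t of the form t = r·k with r ∈ ℕ, all z ∈ X, and every z'' obtained from z by applying f(t), then f(t+1), …, then f(t+k−1). Then the time-varying system is safe: every trace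 x : ℕ → X with x(0) ∈ X₀ and x(t+1) ∈ f(t)(x(t)) for all t satisfies x(t) ∉ Xᵤ for all t ∈ ℕ. -/
/-- Soundness of k-inductive hybrid barrier certificates for time-varying systems. -/
theorem k_inductive_hybrid_barrier_certificate_safety {X : Type*}
    (f : ℕ → X → Set X) (X0 Xu : Set X) (B : ℕ → X → ℝ)
    (k : ℕ) (ε γ d : ℝ)
    (hk : 1 ≤ k) (hε : 0 ≤ ε) (hγ : 0 ≤ γ) (hd : (k : ℝ) * (ε + γ) < d)
    (hInit : ∀ z ∈ X0, B 0 z ≤ 0)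
    (hUnsafe : ∀ t : ℕ, ∀ z ∈ Xu, d ≤ B t z)
    (hStep : ∀ t : ℕ, ∀ z : X, ∀ z' ∈ f t z, B t z' - B t z ≤ ε)
    (hTime : ∀ t : ℕ, ∀ z : X, B (t + 1) z - B t z ≤ γ)
    (hKInd : ∀ r : ℕ, ∀ z : X, ∀ y : ℕ → X, y 0 = z →
      (∀ i < k, y (i + 1) ∈ f (r * k + i) (y i)) →
      B (r * k + k) (y k) - B (r * k) z ≤ 0) :
    ∀ x : ℕ → X, x 0 ∈ X0 → (∀ t : ℕ, x (t + 1) ∈ f t (x t)) →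
      ∀ t : ℕ, x t ∉ Xu := by
  intro x hx0 hx t hxt
  have hblock : ∀ r : ℕ, B (r * k) (x (r * k)) ≤ 0 := by
    intro r
    induction r with
    | zero => simpa using hInit _ hx0
    | succ r ih =>
      have h := hKInd r (x (r * k)) (fun i => x (r * k + i)) rfl
        (fun i _ => hx (r * k + i))
      rw [Nat.succ_mul]
      linarith
  have hdrift : ∀ s i : ℕ, B (s + i) (x (s + i)) ≤ B s (x s) + i * (ε + γ) := by
    intro s i
    induction i with
    | zero => simp
    | succ i ih =>
      have h₁ := hStep (s + i) _ _ (hx (s + i))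
      have h₂ := hTime (s + i) (x (s + i + 1))
      rw [← Nat.add_assoc]
      push_cast
      linarith
  have hmod : ((t % k : ℕ) : ℝ) * (ε + γ) ≤ k * (ε + γ) := by
    have hle : t % k ≤ k := (Nat.mod_lt t hk).le
    gcongr
  have hB := hdrift (t / k * k) (t % k)
  rw [Nat.div_add_mod' t k] at hB
  linarith [hblock (t / k), hUnsafe t _ hxt]
end

section
/- Let a : ℕ → ℝ be a real sequence, k ≥ 1 a natural number, and δ ≥ 0 a real number. Assume a(0) ≤ 0, a(t+1) − a(t) ≤ δ for all t ∈ ℕ, and a((r+1)·k) − a(r·k) ≤ 0 for all r ∈ ℕ. Then a(t) ≤ (k−1)·δ for all t ∈ ℕ. -/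
/-- Real-sequence lemma underlying soundness of k-inductive hybrid barrier certificates. -/
theorem k_inductive_hybrid_sequence_bound (a : ℕ → ℝ) (k : ℕ) (δ : ℝ)
    (hk : 1 ≤ k) (hδ : 0 ≤ δ)
    (h0 : a 0 ≤ 0)
    (hStep : ∀ t : ℕ, a (t + 1) - a t ≤ δ)
    (hBlock : ∀ r : ℕ, a ((r + 1) * k) - a (r * k) ≤ 0) :
    ∀ t : ℕ, a t ≤ ((k : ℝ) - 1) * δ := by
  have hMul : ∀ r : ℕ, a (r * k) ≤ 0 := by
    intro r
    induction r with
    | zero => simpa using h0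
    | succ r ih => linarith [hBlock r]
  have hGrow : ∀ s j : ℕ, a (s + j) ≤ a s + j * δ := by
    intro s j
    induction j with
    | zero => simp
    | succ j ih =>
      have h := hStep (s + j)
      rw [← add_assoc]
      push_cast
      linarith
  intro t
  have hlt : ((t % k : ℕ) : ℝ) ≤ (k : ℝ) - 1 := by
    have h : t % k + 1 ≤ k := Nat.mod_lt t hk
    have h' : ((t % k : ℕ) : ℝ) + 1 ≤ k := by exact_mod_cast h
    linarith
  calc a t = a (t / k * k + t % k) := by rw [Nat.div_add_mod']
    _ ≤ a (t / k * k) + (t % k : ℕ) * δ := hGrow _ _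
    _ ≤ (t % k : ℕ) * δ := by linarith [hMul (t / k)]
    _ ≤ ((k : ℝ) - 1) * δ := mul_le_mul_of_nonneg_right hlt hδ
end
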